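/- arXiv:2006.14164 — 2 statements merged into one kernel-verified Lean document; each statement's English description precedes it below -/
import Mathlib

section
/- Given positive integers n₁, …, n_m and N, define the labeled weighted automaton A₂ over the monoid (ℕ, +, 0) with states q₀, …, q_m, q_{m+1}¹, q_{m+1}², unique initial state q₀, unobservable events u₁, u₂ (ℓ(u₁) = ℓ(u₂) = ε) and observable event e (ℓ(e) = e), and transitions qᵢ →^{u₁ / n_{i+1}} q_{i+1} and qᵢ →^{u₂ / 0} q_{i+1} for 0 ≤ i ≤ m−1, q_m →^{e / 1} q_{m+1}¹, q₀ →^{e / N+1} q_{m+1}², q_{m+1}¹ →^{e / 1} q_{m+1}¹ and q_{m+1}² →^{e / 1} q_{m+1}². Then there exists I ⊆ {1, …, m} with N = Σ_{i∈I} nᵢ if and only if A₂ is NOT strongly periodically detectable. -/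
namespace LWAD

/-- A labeled weighted automaton over a monoid `T`: `lbl e = none` means that
event `e` is unobservable (label ε); initial states all have initial weight `1`. -/
structure LWA (T Q E S : Type*) [Monoid T] where
  trans : Set (Q × E × Q)
  init : Set Q
  wt : Q → E → Q → T
  lbl : E → Option S

variable {T Q E S : Type*} [Monoid T]

/-- A chain (path) over a labeled transition relation `r`; each entry of the
list records the letter and the next state. -/
def Chain {V α : Type*} (r : V → α → V → Prop) : V → List (α × V) → Prop
  | _, [] => True
  | v, (a, u) :: l => r v a u ∧ Chain r u l

/-- The final state of a chain. -/
def chainEnd {V α : Type*} (v : V) (l : List (α × V)) : V :=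
  (l.getLast?.map Prod.snd).getD v

/-- `v'` is reachable from `v` via the labeled transition relation `r`. -/
def ReachVia {V α : Type*} (r : V → α → V → Prop) (v v' : V) : Prop :=
  ∃ l, Chain r v l ∧ chainEnd v l = v'

/-- `IsPath A q l`: `l` is a (possibly empty) path of `A` starting at `q`. -/
def IsPath (A : LWA T Q E S) : Q → List (E × Q) → Prop :=
  Chain fun q e q' => (q, e, q') ∈ A.trans

/-- The end state of a path. -/
def pathEnd (q : Q) (l : List (E × Q)) : Q := chainEnd q l

/-- The weight of a path: the ordered product of its transition weights. -/
def pathWeight (A : LWA T Q E S) : Q → List (E × Q) → T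
  | _, [] => 1
  | q, (e, q') :: l => A.wt q e q' * pathWeight A q' l

/-- Weighted word of a path, with accumulated weight `t`. -/
def wwordAux (A : LWA T Q E S) : T → Q → List (E × Q) → List (E × T)
  | _, _, [] => []
  | t, q, (e, q') :: l => (e, t * A.wt q e q') :: wwordAux A (t * A.wt q e q') q' l

/-- τ(π): the weighted word of the path `l` starting at `q`. -/
def pathWWord (A : LWA T Q E S) (q : Q) (l : List (E × Q)) : List (E × T) :=
  wwordAux A 1 q l

/-- All events of the path are unobservable. -/
def Unobs (A : LWA T Q E S) (l : List (E × Q)) : Prop := ∀ p ∈ l, A.lbl p.1 = none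

/-- The path is instantaneous: all entries of its weighted word equal `1`. -/
def Inst (A : LWA T Q E S) (q : Q) (l : List (E × Q)) : Prop :=
  ∀ p ∈ pathWWord A q l, p.2 = 1

/-- The labeling `ℓ` extended letterwise to weighted words. -/
def obsW (A : LWA T Q E S) (w : List (E × T)) : List (S × T) :=
  w.filterMap fun p => (A.lbl p.1).map fun σ => (σ, p.2)

/-- `M(A, ε | x)`: states reachable from `x` by unobservable instantaneous paths. -/
def instClosure (A : LWA T Q E S) (x : Set Q) : Set Q :=
  {q | ∃ q₀ ∈ x, ∃ l, IsPath A q₀ l ∧ Unobs A l ∧ Inst A q₀ l ∧ pathEnd q₀ l = q}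

/-- `M(A, γ | x)` for nonempty weighted label sequences `γ`. -/
def estPos (A : LWA T Q E S) (x : Set Q) (γ : List (S × T)) : Set Q :=
  {q | ∃ q₀ ∈ x, ∃ s₁ s₂ : List (E × Q),
        IsPath A q₀ (s₁ ++ s₂) ∧
        (∃ p, s₁.getLast? = some p ∧ A.lbl p.1 ≠ none) ∧
        obsW A (pathWWord A q₀ s₁) = γ ∧
        Unobs A s₂ ∧ Inst A (pathEnd q₀ s₁) s₂ ∧
        pathEnd (pathEnd q₀ s₁) s₂ = q}

/-- The current-state estimate `M(A, γ | x)`. -/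
def est (A : LWA T Q E S) (x : Set Q) : List (S × T) → Set Q
  | [] => instClosure A x
  | γ => estPos A x γ

/-- An infinite path of `A` starting at an initial state. -/
structure InfPath (A : LWA T Q E S) where
  st : ℕ → Q
  ev : ℕ → E
  first : st 0 ∈ A.init
  valid : ∀ i, (st i, ev i, st (i + 1)) ∈ A.trans

/-- The ω-weighted word of an infinite path. -/
def InfPath.wword {A : LWA T Q E S} (π : InfPath A) (i : ℕ) : E × T :=
  (π.ev i, ((List.range (i + 1)).map fun j => A.wt (π.st j) (π.ev j) (π.st (j + 1))).prod)

/-- `L^ω(A)`: the ω-weighted words of infinite initial paths of `A`. -/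
def omegaLang (A : LWA T Q E S) : Set (ℕ → E × T) :=
  {w | ∃ π : InfPath A, ∀ i, π.wword i = w i}

/-- The length-`n` prefix of an infinite word. -/
def pre {β : Type*} (w : ℕ → β) (n : ℕ) : List β := (List.range n).map w

/-- The segment `w(n) ⋯ w(n+k-1)` of an infinite word. -/
def seg {β : Type*} (w : ℕ → β) (n k : ℕ) : List β := (List.range k).map fun i => w (n + i)

def StronglyDetectable (A : LWA T Q E S) : Prop :=
  ∃ t : ℕ, 0 < t ∧ ∀ w ∈ omegaLang A, ∀ n : ℕ,
    t ≤ (obsW A (pre w n)).length → (est A A.init (obsW A (pre w n))).ncard = 1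

def StronglyPeriodicallyDetectable (A : LWA T Q E S) : Prop :=
  ∃ t : ℕ, 0 < t ∧ ∀ w ∈ omegaLang A, ∀ n : ℕ, ∃ k : ℕ,
    (obsW A (seg w n k)).length < t ∧
    (est A A.init (obsW A (pre w (n + k)))).ncard = 1

def WeaklyDetectable (A : LWA T Q E S) : Prop :=
  (omegaLang A).Nonempty → ∃ t : ℕ, 0 < t ∧ ∃ w ∈ omegaLang A, ∀ n : ℕ,
    t ≤ (obsW A (pre w n)).length → (est A A.init (obsW A (pre w n))).ncard = 1

def WeaklyPeriodicallyDetectable (A : LWA T Q E S) : Prop :=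
  (omegaLang A).Nonempty → ∃ t : ℕ, 0 < t ∧ ∃ w ∈ omegaLang A, ∀ n : ℕ, ∃ k : ℕ,
    (obsW A (seg w n k)).length < t ∧
    (est A A.init (obsW A (pre w (n + k)))).ncard = 1

def Reachable (A : LWA T Q E S) (q : Q) : Prop :=
  ∃ q₀ ∈ A.init, ∃ l, IsPath A q₀ l ∧ pathEnd q₀ l = q

def DeadlockFree (A : LWA T Q E S) : Prop :=
  ∀ q, Reachable A q → ∃ e q', (q, e, q') ∈ A.trans

def DivergenceFree (A : LWA T Q E S) : Prop :=
  ¬ ∃ q, Reachable A q ∧ ∃ l, l ≠ [] ∧ IsPath A q l ∧ Unobs A l ∧ pathEnd q l = q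

def Deterministic (A : LWA T Q E S) : Prop :=
  (∃ q, A.init = {q}) ∧
  ∀ q e q' q'', (q, e, q') ∈ A.trans → (q, e, q'') ∈ A.trans → q' = q''

/-- The transition relation of the self-composition `CC(A)`. -/
def CCTrans (A : LWA T Q E S) (p : Q × Q) (ee : E × E) (p' : Q × Q) : Prop :=
  A.lbl ee.1 ≠ none ∧ A.lbl ee.1 = A.lbl ee.2 ∧
  ∃ (s₁ s₂ s₃ s₄ : List (E × Q)) (q₇ q₈ : Q),
    IsPath A p.1 (s₁ ++ (ee.1, q₇) :: s₃) ∧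
    IsPath A p.2 (s₂ ++ (ee.2, q₈) :: s₄) ∧
    Unobs A s₁ ∧ Unobs A s₂ ∧ Unobs A s₃ ∧ Unobs A s₄ ∧
    Inst A q₇ s₃ ∧ Inst A q₈ s₄ ∧
    pathEnd q₇ s₃ = p'.1 ∧ pathEnd q₈ s₄ = p'.2 ∧
    pathWeight A p.1 (s₁ ++ [(ee.1, q₇)]) = pathWeight A p.2 (s₂ ++ [(ee.2, q₈)])

/-- The state set `X` of the pre-observer of `A`. -/
def obsStates (A : LWA T Q E S) : Set (Set Q) :=
  insert (est A A.init []) {x | x.Nonempty ∧ ∃ γ : List (S × T), γ ≠ [] ∧ est A A.init γ = x}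

/-- The transition relation of the pre-observer of `A`. -/
def PreObsTrans (A : LWA T Q E S) (x : Set Q) (st : S × T) (x' : Set Q) : Prop :=
  x ∈ obsStates A ∧ x' ∈ obsStates A ∧ x' = estPos A x [st]

/-- An observer of `A`: a finite-alphabet subautomaton of its pre-observer that
keeps at least one transition between every connected pair of states. -/
structure Observer (A : LWA T Q E S) where
  alph : Set (S × T)
  alph_fin : alph.Finite
  tr : Set (Set Q × (S × T) × Set Q)
  tr_sub : ∀ x st x', (x, st, x') ∈ tr → st ∈ alph ∧ PreObsTrans A x st x'
  tr_cover : ∀ x x', (∃ st, PreObsTrans A x st x') → ∃ st, (x, st, x') ∈ tr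

def ObsRel {A : LWA T Q E S} (O : Observer A) (x : Set Q) (st : S × T) (x' : Set Q) : Prop :=
  (x, st, x') ∈ O.tr

/-- The state set of the pre-detector of `A`. -/
def detStates (A : LWA T Q E S) : Set (Set Q) :=
  insert (est A A.init []) {x | 1 ≤ x.ncard ∧ x.ncard ≤ 2}

/-- The transition relation of the pre-detector of `A`. -/
def PreDetTrans (A : LWA T Q E S) (x : Set Q) (st : S × T) (x' : Set Q) : Prop :=
  x ∈ detStates A ∧
  (((estPos A x [st]).ncard = 1 ∧ x' = estPos A x [st]) ∨
    (2 ≤ (estPos A x [st]).ncard ∧ x' ⊆ estPos A x [st] ∧ x'.ncard = 2))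

/-- A detector of `A`: a finite-alphabet subautomaton of its pre-detector that
keeps at least one transition between every connected pair of states. -/
structure Detector (A : LWA T Q E S) where
  alph : Set (S × T)
  alph_fin : alph.Finite
  tr : Set (Set Q × (S × T) × Set Q)
  tr_sub : ∀ x st x', (x, st, x') ∈ tr → st ∈ alph ∧ PreDetTrans A x st x'
  tr_cover : ∀ x x', (∃ st, PreDetTrans A x st x') → ∃ st, (x, st, x') ∈ tr

def DetRel {A : LWA T Q E S} (D : Detector A) (x : Set Q) (st : S × T) (x' : Set Q) : Prop :=
  (x, st, x') ∈ D.tr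


/-- The three events of the automaton `A₂`: `u1`, `u2` are unobservable, `vis`
(the event `e` of the paper) is observable. -/
inductive Ev : Type
  | u1 | u2 | vis

/-- The automaton `A₂` over the monoid `(ℕ, +, 0)` (encoded as
`Multiplicative ℕ`) built from positive integers `n₁, …, n_m` and `N`.
States: `Sum.inl i` is `qᵢ` (`0 ≤ i ≤ m`), `Sum.inr false` is `q_{m+1}¹` and
`Sum.inr true` is `q_{m+1}²`. -/
def A2 (m : ℕ) (nv : Fin m → ℕ) (N : ℕ) :
    LWA (Multiplicative ℕ) (Fin (m + 1) ⊕ Bool) Ev Unit where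
  trans := {t |
    (∃ i : Fin m, t = (Sum.inl i.castSucc, Ev.u1, Sum.inl i.succ)) ∨
    (∃ i : Fin m, t = (Sum.inl i.castSucc, Ev.u2, Sum.inl i.succ)) ∨
    t = (Sum.inl (Fin.last m), Ev.vis, Sum.inr false) ∨
    t = (Sum.inl 0, Ev.vis, Sum.inr true) ∨
    t = (Sum.inr false, Ev.vis, Sum.inr false) ∨
    t = (Sum.inr true, Ev.vis, Sum.inr true)}
  init := {Sum.inl 0}
  wt := fun q e q' => Multiplicative.ofAdd (
    match q, e, q' with
    | Sum.inl i, Ev.u1, _ => if h : (i : ℕ) < m then nv ⟨(i : ℕ), h⟩ else 0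
    | _, Ev.u2, _ => 0
    | Sum.inl _, Ev.vis, Sum.inr true => N + 1
    | _, _, _ => 1)
  lbl := fun e => match e with | Ev.vis => some () | _ => none

section General
variable {T Q E S : Type*} [Monoid T]

lemma est_of_ne (A : LWA T Q E S) (x : Set Q) {γ : List (S × T)} (h : γ ≠ []) :
    est A x γ = estPos A x γ := by
  cases γ with
  | nil => exact absurd rfl h
  | cons a l => rfl

lemma chainEnd_cons {V α : Type*} (v : V) (p : α × V) (l : List (α × V)) :
    chainEnd v (p :: l) = chainEnd p.2 l := by
  cases l with
  | nil => simp [chainEnd]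
  | cons a l =>
    simp only [chainEnd, List.getLast?_cons_cons]
    rw [List.getLast?_eq_getLast_of_ne_nil (by simp)]
    simp

lemma chainEnd_append {V α : Type*} (l l' : List (α × V)) (v : V) :
    chainEnd v (l ++ l') = chainEnd (chainEnd v l) l' := by
  induction l generalizing v with
  | nil => simp [chainEnd]
  | cons p l ih => rw [List.cons_append, chainEnd_cons, chainEnd_cons, ih]

lemma chain_append {V α : Type*} (r : V → α → V → Prop) (l l' : List (α × V)) (v : V) :
    Chain r v (l ++ l') ↔ Chain r v l ∧ Chain r (chainEnd v l) l' := by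
  induction l generalizing v with
  | nil => simp [chainEnd, Chain]
  | cons p l ih =>
    obtain ⟨a, u⟩ := p
    rw [List.cons_append, chainEnd_cons]
    simp only [Chain, ih, and_assoc]

lemma wwordAux_append (A : LWA T Q E S) (l l' : List (E × Q)) (t : T) (q : Q) :
    wwordAux A t q (l ++ l') =
      wwordAux A t q l ++ wwordAux A (t * pathWeight A q l) (chainEnd q l) l' := by
  induction l generalizing t q with
  | nil => simp [chainEnd, wwordAux, pathWeight]
  | cons p l ih =>
    obtain ⟨a, u⟩ := p
    rw [List.cons_append, chainEnd_cons]
    simp only [wwordAux, ih, pathWeight, mul_assoc, List.cons_append]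

lemma pathWeight_append (A : LWA T Q E S) (l l' : List (E × Q)) (q : Q) :
    pathWeight A q (l ++ l') = pathWeight A q l * pathWeight A (chainEnd q l) l' := by
  induction l generalizing q with
  | nil => simp [chainEnd, pathWeight]
  | cons p l ih =>
    obtain ⟨a, u⟩ := p
    rw [List.cons_append, chainEnd_cons]
    simp only [ih, pathWeight, mul_assoc]

/-- The finite prefix of an infinite path. -/
def ipre {A : LWA T Q E S} (π : InfPath A) (n : ℕ) : List (E × Q) :=
  (List.range n).map fun i => (π.ev i, π.st (i + 1))

lemma ipre_succ {A : LWA T Q E S} (π : InfPath A) (n : ℕ) :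
    ipre π (n + 1) = ipre π n ++ [(π.ev n, π.st (n + 1))] := by
  simp [ipre, List.range_succ]

lemma ipre_end {A : LWA T Q E S} (π : InfPath A) (n : ℕ) :
    chainEnd (π.st 0) (ipre π n) = π.st n := by
  cases n with
  | zero => simp [ipre, chainEnd]
  | succ n => rw [ipre_succ]; simp [chainEnd]

lemma ipre_path {A : LWA T Q E S} (π : InfPath A) (n : ℕ) :
    IsPath A (π.st 0) (ipre π n) := by
  induction n with
  | zero => simp [ipre, IsPath, Chain]
  | succ n ih =>
    rw [ipre_succ]
    unfold IsPath
    rw [chain_append, ipre_end]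
    exact ⟨ih, π.valid n, trivial⟩

lemma ipre_weight {A : LWA T Q E S} (π : InfPath A) (n : ℕ) :
    pathWeight A (π.st 0) (ipre π n) =
      ((List.range n).map fun j => A.wt (π.st j) (π.ev j) (π.st (j + 1))).prod := by
  induction n with
  | zero => simp [ipre, pathWeight]
  | succ n ih =>
    rw [ipre_succ, pathWeight_append, ih, ipre_end]
    simp [List.range_succ, pathWeight]

lemma pre_wword {A : LWA T Q E S} (π : InfPath A) (n : ℕ) :
    pre π.wword n = pathWWord A (π.st 0) (ipre π n) := by
  induction n with
  | zero => simp [pre, ipre, pathWWord, wwordAux]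
  | succ n ih =>
    rw [ipre_succ]
    unfold pathWWord at *
    rw [wwordAux_append, ← ih, ipre_end, ipre_weight]
    simp [pre, wwordAux, List.range_succ, InfPath.wword]

end General

section Auto
variable {m : ℕ} {nv : Fin m → ℕ} {N : ℕ}

lemma from_inr {b : Bool} {e : Ev} {q : Fin (m + 1) ⊕ Bool}
    (h : (Sum.inr b, e, q) ∈ (A2 m nv N).trans) : e = Ev.vis ∧ q = Sum.inr b := by
  simp only [A2, Set.mem_ofPred_eq, Prod.mk.injEq] at h
  rcases h with ⟨i, h, -⟩ | ⟨i, h, -⟩ | ⟨h, -⟩ | ⟨h, -⟩ | ⟨h, h', h''⟩ | ⟨h, h', h''⟩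
  all_goals first | exact ⟨h', h''.trans h.symm⟩ | exact absurd h (by simp)

lemma to_inr {b : Bool} {e : Ev} {q : Fin (m + 1) ⊕ Bool}
    (h : (q, e, Sum.inr b) ∈ (A2 m nv N).trans) : e = Ev.vis := by
  simp only [A2, Set.mem_ofPred_eq, Prod.mk.injEq] at h
  rcases h with ⟨i, -, -, h⟩ | ⟨i, -, -, h⟩ | ⟨-, h, -⟩ | ⟨-, h, -⟩ | ⟨-, h, -⟩ | ⟨-, h, -⟩
  all_goals first | exact h | exact absurd h (by simp)

lemma end_inr (l : List (Ev × (Fin (m + 1) ⊕ Bool))) (b : Bool)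
    (h : IsPath (A2 m nv N) (Sum.inr b) l) : chainEnd (Sum.inr b) l = Sum.inr b := by
  induction l with
  | nil => simp [chainEnd]
  | cons p l ih =>
    obtain ⟨e, q⟩ := p
    obtain ⟨h1, h2⟩ := h
    obtain ⟨-, rfl⟩ := from_inr h1
    rw [chainEnd_cons]
    exact ih h2

lemma key (l : List (Ev × (Fin (m + 1) ⊕ Bool))) : ∀ (i : Fin (m + 1)) (t : Multiplicative ℕ),
    IsPath (A2 m nv N) (Sum.inl i) l →
    (obsW (A2 m nv N) (wwordAux (A2 m nv N) t (Sum.inl i) l) = []) ∨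
    ∃ T tl, obsW (A2 m nv N) (wwordAux (A2 m nv N) t (Sum.inl i) l) = ((), T) :: tl ∧
      ((chainEnd (Sum.inl i) l = Sum.inr false ∧
        ∃ I : Finset (Fin m), (∀ j ∈ I, i ≤ j.castSucc) ∧
          T = t * Multiplicative.ofAdd (∑ j ∈ I, nv j + 1)) ∨
       (chainEnd (Sum.inl i) l = Sum.inr true ∧ i = 0 ∧
          T = t * Multiplicative.ofAdd (N + 1))) := by
  induction l with
  | nil => intro i t _; left; simp [wwordAux, obsW]
  | cons p l ih =>
    obtain ⟨e, q⟩ := p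
    rintro i t ⟨h1, h2⟩
    rw [chainEnd_cons]
    simp only [A2, Set.mem_ofPred_eq, Prod.mk.injEq] at h1
    rcases h1 with ⟨i', h, rfl, rfl⟩ | ⟨i', h, rfl, rfl⟩ | ⟨h, rfl, rfl⟩ | ⟨h, rfl, rfl⟩ |
      ⟨h, -⟩ | ⟨h, -⟩
    · obtain rfl := Sum.inl_injective h
      rcases ih i'.succ (t * Multiplicative.ofAdd (nv i')) h2 with h3 | ⟨T, tl, h3, h4⟩
      · left
        simpa [wwordAux, obsW, A2] using h3
      · right
        refine ⟨T, tl, by simpa [wwordAux, obsW, A2] using h3, ?_⟩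
        rcases h4 with ⟨h4, I, hI, hT⟩ | ⟨-, h4, -⟩
        · left
          refine ⟨h4, insert i' I, ?_, ?_⟩
          · intro j hj
            rcases Finset.mem_insert.1 hj with rfl | hj
            · exact le_rfl
            · exact (Fin.castSucc_lt_succ).le.trans (hI j hj)
          · rw [Finset.sum_insert, hT, mul_assoc, ← ofAdd_add, add_assoc]
            intro hj
            exact absurd (hI _ hj) (not_le.2 Fin.castSucc_lt_succ)
        · exact absurd h4 (Fin.succ_ne_zero _)
    · obtain rfl := Sum.inl_injective h
      rcases ih i'.succ t h2 with h3 | ⟨T, tl, h3, h4⟩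
      · left
        simpa [wwordAux, obsW, A2] using h3
      · right
        refine ⟨T, tl, by simpa [wwordAux, obsW, A2] using h3, ?_⟩
        rcases h4 with ⟨h4, I, hI, hT⟩ | ⟨-, h4, -⟩
        · left
          exact ⟨h4, I, fun j hj => (Fin.castSucc_lt_succ).le.trans (hI j hj), hT⟩
        · exact absurd h4 (Fin.succ_ne_zero _)
    · right
      refine ⟨t * Multiplicative.ofAdd 1, obsW (A2 m nv N) (wwordAux (A2 m nv N)
        (t * Multiplicative.ofAdd 1) (Sum.inr false) l), by simp [wwordAux, obsW, A2], Or.inl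
          ⟨end_inr _ _ h2, ∅, by simp, by simp⟩⟩
    · right
      refine ⟨t * Multiplicative.ofAdd (N + 1), obsW (A2 m nv N) (wwordAux (A2 m nv N)
        (t * Multiplicative.ofAdd (N + 1)) (Sum.inr true) l), by simp [wwordAux, obsW, A2], Or.inr
          ⟨end_inr _ _ h2, Sum.inl_injective h, rfl⟩⟩
    · exact absurd h (by simp)
    · exact absurd h (by simp)

/-- The loop at a final state. -/
def loop (m : ℕ) (b : Bool) (k : ℕ) : List (Ev × (Fin (m + 1) ⊕ Bool)) :=
  List.replicate k (Ev.vis, Sum.inr b)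

lemma loop_path (b : Bool) (k : ℕ) : IsPath (A2 m nv N) (Sum.inr b) (loop m b k) := by
  induction k with
  | zero => trivial
  | succ k ih => exact ⟨by cases b <;> simp [A2], ih⟩

lemma loop_obs (k : ℕ) (t : Multiplicative ℕ) :
    obsW (A2 m nv N) (wwordAux (A2 m nv N) t (Sum.inr false) (loop m false k)) =
    obsW (A2 m nv N) (wwordAux (A2 m nv N) t (Sum.inr true) (loop m true k)) := by
  induction k generalizing t with
  | zero => rfl
  | succ k ih =>
    have := ih (t * Multiplicative.ofAdd 1)
    simpa [loop, List.replicate_succ, wwordAux, obsW, A2] using this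

lemma run (I : Finset (Fin m)) (k : ℕ) (i : Fin (m + 1)) : ∀ t : Multiplicative ℕ,
    ∃ l, IsPath (A2 m nv N) (Sum.inl i) (l ++ loop m false (k + 1)) ∧
      obsW (A2 m nv N) (wwordAux (A2 m nv N) t (Sum.inl i) (l ++ loop m false (k + 1))) =
        ((), t * Multiplicative.ofAdd (∑ j ∈ I with i ≤ j.castSucc, nv j + 1)) ::
        obsW (A2 m nv N) (wwordAux (A2 m nv N)
          (t * Multiplicative.ofAdd (∑ j ∈ I with i ≤ j.castSucc, nv j + 1))
            (Sum.inr false) (loop m false k)) := by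
  induction i using Fin.reverseInduction with
  | last =>
    intro t
    have : (I.filter fun j => Fin.last m ≤ j.castSucc) = ∅ := by
      ext j
      simp
    refine ⟨[], ⟨by simp [A2], loop_path _ _⟩, ?_⟩
    rw [this]
    simp [loop, List.replicate_succ, wwordAux, obsW, A2]
  | cast i ih =>
    intro t
    by_cases hi : i ∈ I
    · obtain ⟨l, h1, h2⟩ := ih (t * Multiplicative.ofAdd (nv i))
      have hs : (I.filter fun j => i.castSucc ≤ j.castSucc) =
          insert i (I.filter fun j => i.succ ≤ j.castSucc) := by
        ext j
        simp only [Finset.mem_filter, Finset.mem_insert, Fin.le_def, Fin.ext_iff,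
          Fin.val_castSucc, Fin.val_succ]
        constructor
        · rintro ⟨a, b⟩
          by_cases h : (j : ℕ) = i
          · exact Or.inl h
          · exact Or.inr ⟨a, by omega⟩
        · rintro (h | ⟨a, b⟩)
          · obtain rfl := Fin.ext h
            exact ⟨hi, le_rfl⟩
          · exact ⟨a, by omega⟩
      refine ⟨(Ev.u1, Sum.inl i.succ) :: l, ⟨by simp [A2], h1⟩, ?_⟩
      rw [hs, Finset.sum_insert (by simp [Fin.le_def]), add_assoc, ofAdd_add, ← mul_assoc, ← h2]
      simp [wwordAux, obsW, A2]
    · obtain ⟨l, h1, h2⟩ := ih t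
      have hs : (I.filter fun j => i.castSucc ≤ j.castSucc) =
          (I.filter fun j => i.succ ≤ j.castSucc) := by
        ext j
        simp only [Finset.mem_filter, Fin.le_def, Fin.val_castSucc, Fin.val_succ]
        constructor
        · rintro ⟨a, b⟩
          refine ⟨a, ?_⟩
          by_contra h
          have : j = i := Fin.ext (by omega)
          exact hi (this ▸ a)
        · rintro ⟨a, b⟩
          exact ⟨a, by omega⟩
      refine ⟨(Ev.u2, Sum.inl i.succ) :: l, ⟨by simp [A2], h1⟩, ?_⟩
      rw [hs, ← h2]
      simp [wwordAux, obsW, A2]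

lemma loop_last (b : Bool) (k : ℕ) (l : List (Ev × (Fin (m + 1) ⊕ Bool))) :
    (l ++ loop m b (k + 1)).getLast? = some (Ev.vis, Sum.inr b) := by
  rw [loop, List.replicate_succ', ← List.append_assoc]
  simp

/-- The infinite path taking the weight `N + 1` transition first. -/
def infTrue (m : ℕ) (nv : Fin m → ℕ) (N : ℕ) : InfPath (A2 m nv N) where
  st := fun i => if i = 0 then Sum.inl 0 else Sum.inr true
  ev := fun _ => Ev.vis
  first := by simp [A2]
  valid := by
    intro i
    by_cases h : i = 0 <;> simp [A2, h]

lemma st_progress (π : InfPath (A2 m nv N)) (n : ℕ) :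
    (∃ b, π.st n = Sum.inr b) ∨ ∃ i : Fin (m + 1), π.st n = Sum.inl i ∧ (i : ℕ) = n := by
  induction n with
  | zero => right; exact ⟨0, π.first, rfl⟩
  | succ n ih =>
    have hv := π.valid n
    rcases ih with ⟨b, h⟩ | ⟨i, h, hi⟩
    · rw [h] at hv
      exact Or.inl ⟨b, (from_inr hv).2⟩
    · rw [h] at hv
      simp only [A2, Set.mem_ofPred_eq, Prod.mk.injEq] at hv
      rcases hv with ⟨j, h1, -, h2⟩ | ⟨j, h1, -, h2⟩ | ⟨-, -, h2⟩ | ⟨-, -, h2⟩ | ⟨-, -, h2⟩ |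
        ⟨-, -, h2⟩
      · right
        obtain rfl := Sum.inl_injective h1
        exact ⟨_, h2, by simpa using hi⟩
      · right
        obtain rfl := Sum.inl_injective h1
        exact ⟨_, h2, by simpa using hi⟩
      all_goals exact Or.inl ⟨_, h2⟩

lemma not_spd (I : Finset (Fin m)) (hI : N = ∑ i ∈ I, nv i) :
    ¬ StronglyPeriodicallyDetectable (A2 m nv N) := by
  rintro ⟨t, -, h⟩
  obtain ⟨k, -, h⟩ := h _ ⟨infTrue m nv N, fun _ => rfl⟩ 1
  have hp : ipre (infTrue m nv N) (1 + k) = loop m true (k + 1) := by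
    simp [ipre, infTrue, loop, add_comm]
  rw [pre_wword, hp] at h
  have hst : (infTrue m nv N).st 0 = Sum.inl 0 := rfl
  rw [hst] at h
  have hobs : obsW (A2 m nv N) (pathWWord (A2 m nv N) (Sum.inl 0) (loop m true (k + 1))) =
      ((), Multiplicative.ofAdd (N + 1)) :: obsW (A2 m nv N) (wwordAux (A2 m nv N)
        (Multiplicative.ofAdd (N + 1)) (Sum.inr true) (loop m true k)) := by
    simp [loop, List.replicate_succ, pathWWord, wwordAux, obsW, A2]
  rw [est_of_ne _ _ (by rw [hobs]; simp)] at h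
  obtain ⟨q, hq⟩ := Set.ncard_eq_one.1 h
  have hT : (Sum.inr true : Fin (m + 1) ⊕ Bool) ∈ ({q} : Set _) := by
    rw [← hq]
    refine ⟨Sum.inl 0, rfl, loop m true (k + 1), [], ?_, ⟨_, loop_last true k [], by simp [A2]⟩,
      rfl, by simp [Unobs], by simp [Inst, pathWWord, wwordAux], ?_⟩
    · rw [List.append_nil]
      exact ⟨by simp [A2], loop_path _ _⟩
    · rw [pathEnd, pathEnd, ← chainEnd_append, List.append_nil, chainEnd]
      rw [← List.nil_append (loop m true (k + 1)), loop_last]; rfl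
  have hF : (Sum.inr false : Fin (m + 1) ⊕ Bool) ∈ ({q} : Set _) := by
    rw [← hq]
    obtain ⟨l, h1, h2⟩ := run (nv := nv) (N := N) I k 0 1
    have hf : (I.filter fun j => (0 : Fin (m + 1)) ≤ j.castSucc) = I := by
      ext j; simp
    rw [hf, ← hI, one_mul, loop_obs] at h2
    refine ⟨Sum.inl 0, rfl, l ++ loop m false (k + 1), [], ?_,
      ⟨_, loop_last false k l, by simp [A2]⟩,
      ?_, by simp [Unobs], by simp [Inst, pathWWord, wwordAux], ?_⟩
    · rwa [List.append_nil]
    · rw [hobs]; exact h2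
    · rw [pathEnd, pathEnd, ← chainEnd_append, List.append_nil, chainEnd, loop_last]; rfl
  have := hT.trans hF.symm
  simp at this

lemma spd (hno : ¬ ∃ I : Finset (Fin m), N = ∑ i ∈ I, nv i) :
    StronglyPeriodicallyDetectable (A2 m nv N) := by
  refine ⟨m + 2, by omega, ?_⟩
  rintro w ⟨π, hw⟩ n
  obtain rfl : π.wword = w := funext hw
  refine ⟨m + 1, ?_, ?_⟩
  · refine lt_of_le_of_lt (List.length_filterMap_le _ _) ?_
    simp [seg]
  have h0 : π.st 0 = Sum.inl 0 := π.first
  have hb : ∃ b, π.st (n + (m + 1)) = Sum.inr b := by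
    rcases st_progress π (n + (m + 1)) with h | ⟨i, -, hi⟩
    · exact h
    · have := i.2
      omega
  obtain ⟨b, hb⟩ := hb
  have hev : π.ev (n + m) = Ev.vis := by
    have := π.valid (n + m)
    rw [add_assoc, hb] at this
    exact to_inr this
  have hlast : (ipre π (n + (m + 1))).getLast? = some (Ev.vis, Sum.inr b) := by
    rw [← add_assoc, ipre_succ, hev, add_assoc, hb]; simp
  have hne : obsW (A2 m nv N) (pre π.wword (n + (m + 1))) ≠ [] := by
    rw [← add_assoc]
    simp [pre, obsW, List.range_succ, InfPath.wword, hev, A2]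
  rw [est_of_ne _ _ hne]
  rw [pre_wword] at hne ⊢
  have hpath := ipre_path π (n + (m + 1))
  have hend := ipre_end π (n + (m + 1))
  rw [hb] at hend
  rw [h0] at hne hpath hend ⊢
  rw [Set.ncard_eq_one]
  refine ⟨Sum.inr b, Set.eq_singleton_iff_unique_mem.2 ⟨?_, ?_⟩⟩
  · refine ⟨Sum.inl 0, rfl, _, [], ?_, ⟨_, hlast, by simp [A2]⟩,
      rfl, by simp [Unobs], by simp [Inst, pathWWord, wwordAux], ?_⟩
    · rwa [List.append_nil]
    · rw [pathEnd, pathEnd, ← chainEnd_append, List.append_nil, hend]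
  · rintro q ⟨q₀, hq₀, s₁, s₂, hp, -, ho, -, -, rfl⟩
    obtain rfl : q₀ = Sum.inl 0 := hq₀
    unfold IsPath at hp
    rw [chain_append] at hp
    obtain ⟨hp1, hp2⟩ := hp
    unfold pathWWord at ho hne
    rcases key _ 0 1 hpath with hk | ⟨T, tl, hk, hk'⟩
    · exact absurd hk hne
    rcases key s₁ 0 1 hp1 with hj | ⟨T', tl', hj, hj'⟩
    · rw [ho] at hj; exact absurd hj hne
    rw [ho, hk] at hj
    obtain rfl : T = T' := by
      simp only [List.cons.injEq, Prod.mk.injEq] at hj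
      exact hj.1.2
    have hs : chainEnd (Sum.inl 0) s₁ = Sum.inr b := by
      rw [← hend]
      rcases hk' with ⟨a1, I, -, hI⟩ | ⟨a1, -, hI⟩ <;>
        rcases hj' with ⟨a2, J, -, hJ⟩ | ⟨a2, -, hJ⟩
      · rw [a1, a2]
      · exfalso
        rw [hI] at hJ
        simp only [one_mul, EmbeddingLike.apply_eq_iff_eq] at hJ
        exact hno ⟨I, by omega⟩
      · exfalso
        rw [hI] at hJ
        simp only [one_mul, EmbeddingLike.apply_eq_iff_eq] at hJ
        exact hno ⟨J, by omega⟩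
      · rw [a1, a2]
    rw [hs] at hp2
    rw [pathEnd, pathEnd, hs]
    exact end_inr _ _ hp2

end Auto

/-- Theorem: the subset-sum instance `(n₁, …, n_m, N)` has a solution iff `A₂`
is not strongly periodically detectable. -/
theorem subsetSum_iff_not_stronglyPeriodicallyDetectable
    (m : ℕ) (hm : 0 < m) (nv : Fin m → ℕ) (hnv : ∀ i, 0 < nv i)
    (N : ℕ) (hN : 0 < N) :
    (∃ I : Finset (Fin m), N = ∑ i ∈ I, nv i) ↔
      ¬ StronglyPeriodicallyDetectable (A2 m nv N) := by
  constructor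
  · rintro ⟨I, hI⟩
    exact not_spd I hI
  · intro h
    by_contra hno
    exact h (spd hno)

end LWAD
end

section
/- Let A be a labeled weighted automaton over a monoid 𝔐 = (T, ⊗, 1) that is deadlock-free and divergence-free. If A is strongly detectable, then A is strongly periodically detectable. -/
namespace LWAD

variable {T Q E S : Type*} [Monoid T]

/-- The finite path formed by `k` steps of an infinite path from position `n`. -/
def InfPath.part {A : LWA T Q E S} (π : InfPath A) : ℕ → ℕ → List (E × Q)
  | _, 0 => []
  | n, k + 1 => (π.ev n, π.st (n + 1)) :: InfPath.part π (n + 1) k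

theorem InfPath.part_isPath {A : LWA T Q E S} (π : InfPath A) (n k : ℕ) :
    IsPath A (π.st n) (π.part n k) := by
  induction k generalizing n with
  | zero => trivial
  | succ k ih => exact ⟨π.valid n, ih (n + 1)⟩

theorem pathEnd_cons (q : Q) (p : E × Q) (l : List (E × Q)) :
    pathEnd q (p :: l) = pathEnd p.2 l := by
  unfold pathEnd chainEnd
  rw [List.getLast?_cons]
  cases h : l.getLast? <;> simp

theorem InfPath.part_end {A : LWA T Q E S} (π : InfPath A) (n k : ℕ) :
    pathEnd (π.st n) (π.part n k) = π.st (n + k) := by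
  induction k generalizing n with
  | zero => rfl
  | succ k ih =>
    rw [InfPath.part, pathEnd_cons, ih]
    congr 1
    omega

theorem InfPath.part_unobs {A : LWA T Q E S} (π : InfPath A) (n k : ℕ)
    (h : ∀ i, n ≤ i → A.lbl (π.ev i) = none) : Unobs A (π.part n k) := by
  induction k generalizing n with
  | zero => intro p hp; simp [InfPath.part] at hp
  | succ k ih =>
    intro p hp
    rw [InfPath.part, List.mem_cons] at hp
    rcases hp with rfl | hp
    · exact h n le_rfl
    · exact ih (n + 1) (fun i hi => h i (by omega)) p hp

theorem InfPath.exists_obs [Finite Q] {A : LWA T Q E S} (hdiv : DivergenceFree A)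
    (π : InfPath A) (n : ℕ) : ∃ i, n ≤ i ∧ A.lbl (π.ev i) ≠ none := by
  by_contra hcon
  push Not at hcon
  obtain ⟨i, j, hne, heq⟩ := Finite.exists_ne_map_eq_of_infinite (fun i => π.st (n + i))
  have key : ∀ i j, i < j → π.st (n + i) = π.st (n + j) → False := by
    intro i j hij heq
    apply hdiv
    refine ⟨π.st (n + i), ⟨π.st 0, π.first, π.part 0 (n + i), π.part_isPath _ _, ?_⟩,
      π.part (n + i) (j - i), ?_, π.part_isPath _ _,
      π.part_unobs _ _ (fun m hm => hcon m (by omega)), ?_⟩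
    · rw [π.part_end, Nat.zero_add]
    · obtain ⟨d, hd⟩ : ∃ d, j - i = d + 1 := ⟨j - i - 1, by omega⟩
      rw [hd, InfPath.part]
      simp
    · rw [π.part_end, heq]
      congr 1
      omega
  rcases lt_or_gt_of_ne hne with h | h
  · exact key i j h heq
  · exact key j i h heq.symm

theorem obsW_append (A : LWA T Q E S) (u v : List (E × T)) :
    obsW A (u ++ v) = obsW A u ++ obsW A v := by
  simp [obsW]

theorem pre_add {β : Type*} (w : ℕ → β) (n k : ℕ) : pre w (n + k) = pre w n ++ seg w n k := by
  simp [pre, seg, List.range_add]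

theorem pre_succ {β : Type*} (w : ℕ → β) (n : ℕ) : pre w (n + 1) = pre w n ++ [w n] := by
  simp [pre, List.range_succ]

theorem obsW_length_pre_mono (A : LWA T Q E S) (w : ℕ → E × T) (n k : ℕ) :
    (obsW A (pre w n)).length ≤ (obsW A (pre w (n + k))).length := by
  rw [pre_add, obsW_append, List.length_append]
  omega

theorem obsW_singleton_length_le (A : LWA T Q E S) (p : E × T) :
    (obsW A [p]).length ≤ 1 :=
  List.length_filterMap_le _ _

theorem exists_obsW_ge [Finite Q] {A : LWA T Q E S} (hdiv : DivergenceFree A)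
    (π : InfPath A) (w : ℕ → E × T) (hw : ∀ i, π.wword i = w i) (n t : ℕ) :
    ∃ k, t ≤ (obsW A (pre w (n + k))).length := by
  induction t with
  | zero => exact ⟨0, Nat.zero_le _⟩
  | succ t ih =>
    obtain ⟨k, hk⟩ := ih
    obtain ⟨i, hi, hobs⟩ := π.exists_obs hdiv (n + k)
    refine ⟨i + 1 - n, ?_⟩
    have e : n + (i + 1 - n) = i + 1 := by omega
    have h1 := obsW_length_pre_mono A w (n + k) (i - (n + k))
    rw [show n + k + (i - (n + k)) = i by omega] at h1
    rw [e, pre_succ, obsW_append, List.length_append]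
    have h2 : (obsW A [w i]).length = 1 := by
      obtain ⟨σ, hσ⟩ := Option.ne_none_iff_exists'.mp hobs
      rw [← hw i]
      simp [obsW, InfPath.wword, hσ]
    omega

/-- For deadlock-free and divergence-free labeled weighted automata over a
monoid, strong detectability implies strong periodic detectability. -/
theorem stronglyDetectable_implies_stronglyPeriodicallyDetectable
    [Fintype Q] [Fintype E] [Fintype S] (A : LWA T Q E S)
    (hdl : DeadlockFree A) (hdiv : DivergenceFree A)
    (hsd : StronglyDetectable A) :
    StronglyPeriodicallyDetectable A := by
  obtain ⟨t, ht, h⟩ := hsd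
  refine ⟨t + 1, by omega, ?_⟩
  intro w hw n
  obtain ⟨π, hπ⟩ := hw
  classical
  have hex := exists_obsW_ge hdiv π w hπ n t
  refine ⟨Nat.find hex, ?_, h w ⟨π, hπ⟩ _ (Nat.find_spec hex)⟩
  rcases hk : Nat.find hex with _ | k
  · simp [seg, obsW]
  · have hlt := Nat.find_min hex (m := k) (by omega)
    have h1 : (obsW A (pre w (n + (k + 1)))).length ≤ t := by
      rw [← Nat.add_assoc, pre_succ, obsW_append, List.length_append]
      have := obsW_singleton_length_le A (w (n + k))
      omega
    rw [pre_add, obsW_append, List.length_append] at h1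
    omega

end LWAD
end
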